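/- Let p>2, β=1/(p−1), c_p=(1−β)^{−1}β^β, T>0, and α≥(p−1)/(p−2). Define u(x,y,t)=c_p·[(|x|^{2α}+(T−t)^α+y)^{1−β}−(|x|^{2α}+(T−t)^α)^{1−β}] on Q=(−1,1)×(0,1)×(0,T). Then u(x,0,t)=0, u is a classical solution in Q of u_t−Δu=|∇u|^p+f for some bounded function f on Q, u has an isolated gradient blowup point at (0,0,T), u satisfies u_xx≥−C and |u_t|≤C on Q for some C>0, and the second derivative u_xx extends continuously to (0,0,T) (with zero limit) if and only if α>(p−1)/(p−2). -/

import Mathlib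

open Real Set Filter MeasureTheory

noncomputable section

/-- Partial derivative of `u(x,y,t)` with respect to `x`. -/
def pdx (u : ℝ → ℝ → ℝ → ℝ) (x y t : ℝ) : ℝ := deriv (fun s => u s y t) x

/-- Partial derivative with respect to `y`. -/
def pdy (u : ℝ → ℝ → ℝ → ℝ) (x y t : ℝ) : ℝ := deriv (fun s => u x s t) y

/-- Partial derivative with respect to `t`. -/
def pdt (u : ℝ → ℝ → ℝ → ℝ) (x y t : ℝ) : ℝ := deriv (fun s => u x y s) t

/-- Second partial derivative with respect to `x`. -/
def pdxx (u : ℝ → ℝ → ℝ → ℝ) (x y t : ℝ) : ℝ := deriv (fun s => pdx u s y t) x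

/-- Second partial derivative with respect to `y`. -/
def pdyy (u : ℝ → ℝ → ℝ → ℝ) (x y t : ℝ) : ℝ := deriv (fun s => pdy u x s t) y

/-- Mixed second partial derivative `u_{xy}` (first `x`, then `y`). -/
def pdxy (u : ℝ → ℝ → ℝ → ℝ) (x y t : ℝ) : ℝ := deriv (fun s => pdx u x s t) y

/-- The norm of the spatial gradient, `|∇u| = (u_x² + u_y²)^{1/2}`. -/
def gradNorm (u : ℝ → ℝ → ℝ → ℝ) (x y t : ℝ) : ℝ :=
  Real.sqrt ((pdx u x y t) ^ 2 + (pdy u x y t) ^ 2)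

/-- `C^{2,1}`-type regularity of `u` at the point `(x,y,t)`: twice (continuously)
differentiable in the space variables and once in time. -/
def C21At (u : ℝ → ℝ → ℝ → ℝ) (x y t : ℝ) : Prop :=
  DifferentiableAt ℝ (fun s => u s y t) x ∧
  DifferentiableAt ℝ (fun s => u x s t) y ∧
  DifferentiableAt ℝ (fun s => u x y s) t ∧
  DifferentiableAt ℝ (fun s => pdx u s y t) x ∧
  DifferentiableAt ℝ (fun s => pdy u x s t) y ∧
  DifferentiableAt ℝ (fun s => pdx u x s t) y ∧
  ContinuousAt (fun q : ℝ × ℝ × ℝ => u q.1 q.2.1 q.2.2) (x, y, t) ∧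
  ContinuousAt (fun q : ℝ × ℝ × ℝ => pdx u q.1 q.2.1 q.2.2) (x, y, t) ∧
  ContinuousAt (fun q : ℝ × ℝ × ℝ => pdy u q.1 q.2.1 q.2.2) (x, y, t) ∧
  ContinuousAt (fun q : ℝ × ℝ × ℝ => pdt u q.1 q.2.1 q.2.2) (x, y, t) ∧
  ContinuousAt (fun q : ℝ × ℝ × ℝ => pdxx u q.1 q.2.1 q.2.2) (x, y, t) ∧
  ContinuousAt (fun q : ℝ × ℝ × ℝ => pdyy u q.1 q.2.1 q.2.2) (x, y, t) ∧
  ContinuousAt (fun q : ℝ × ℝ × ℝ => pdxy u q.1 q.2.1 q.2.2) (x, y, t)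

/-- `u` is a nonnegative classical solution of `u_t - Δu = |∇u|^p` in
`Q_T = ω × (0,T)`, `ω = (-L,L) × (0,L)`, with `u = 0` on `Γ_T = (-L,L) × {0} × (0,T)`. -/
structure ClassicalSolution (p L T : ℝ) (u : ℝ → ℝ → ℝ → ℝ) : Prop where
  nonneg : ∀ ⦃x y t : ℝ⦄, |x| ≤ L → y ∈ Icc (0:ℝ) L → t ∈ Ioo 0 T → 0 ≤ u x y t
  smooth : ∀ ⦃x y t : ℝ⦄, |x| ≤ L → y ∈ Icc (0:ℝ) L → t ∈ Ioo 0 T → C21At u x y t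
  pde : ∀ ⦃x y t : ℝ⦄, |x| < L → y ∈ Ioo (0:ℝ) L → t ∈ Ioo 0 T →
    pdt u x y t - (pdxx u x y t + pdyy u x y t) = gradNorm u x y t ^ p
  bc : ∀ ⦃x t : ℝ⦄, |x| < L → t ∈ Ioo 0 T → u x 0 t = 0

/-- `u` has an isolated gradient blow-up point at `(0,0,T)`:
`limsup |∇u| = ∞` at `(0,0,T)` while `∇u` stays bounded on `K × (0,T)` for every
compact `K ⊆ ω̄ \ {(0,0)}`. -/
structure IsolatedGBU (L T : ℝ) (u : ℝ → ℝ → ℝ → ℝ) : Prop where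
  blowup : ∀ M : ℝ, ∀ δ > (0:ℝ), ∃ x y t : ℝ, |x| ≤ L ∧ y ∈ Icc (0:ℝ) L ∧
    t ∈ Ioo 0 T ∧ |x| < δ ∧ |y| < δ ∧ T - δ < t ∧ M < gradNorm u x y t
  bounded : ∀ K : Set (ℝ × ℝ), IsCompact K →
    K ⊆ (Icc (-L) L ×ˢ Icc (0:ℝ) L) \ {((0:ℝ), (0:ℝ))} →
    ∃ M : ℝ, ∀ q ∈ K, ∀ t ∈ Ioo (0:ℝ) T, gradNorm u q.1 q.2 t ≤ M

/-- `u` extends as a `C^{2,1}` function to `(ω̄' × [T/2,T]) \ {(0,0,T)}`,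
`ω' = (-L/2,L/2) × (0,L/2)`; values and derivatives at `t = T` refer to this extension. -/
def ExtC21 (L T : ℝ) (u : ℝ → ℝ → ℝ → ℝ) : Prop :=
  ∀ ⦃x y t : ℝ⦄, |x| ≤ L / 2 → y ∈ Icc (0:ℝ) (L / 2) → t ∈ Icc (T / 2) T →
    ¬(x = 0 ∧ y = 0 ∧ t = T) → C21At u x y t

/-- The monotonicity condition `x·u_x ≤ 0` in `Q_T`. -/
def MonCond (L T : ℝ) (u : ℝ → ℝ → ℝ → ℝ) : Prop :=
  ∀ ⦃x y t : ℝ⦄, |x| < L → y ∈ Ioo (0:ℝ) L → t ∈ Ioo 0 T → x * pdx u x y t ≤ 0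

def qh (a T x t : ℝ) : ℝ := |x| ^ (2 * a) + (T - t) ^ a
def qGx (a x : ℝ) : ℝ := 2 * a * |x| ^ (2 * a - 2) * x
def qGxx (a x : ℝ) : ℝ := 2 * a * (2 * a - 1) * |x| ^ (2 * a - 2)
def qUx (a b d T x y t : ℝ) : ℝ :=
  d * qGx a x * ((qh a T x t + y) ^ (-b) - (qh a T x t) ^ (-b))
def qUy (a b d T x y t : ℝ) : ℝ := d * (qh a T x t + y) ^ (-b)
def qUt (a b d T x y t : ℝ) : ℝ :=
  d * (-(a * (T - t) ^ (a - 1))) * ((qh a T x t + y) ^ (-b) - (qh a T x t) ^ (-b))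
def qUxx (a b d T x y t : ℝ) : ℝ :=
  d * qGxx a x * ((qh a T x t + y) ^ (-b) - (qh a T x t) ^ (-b))
   + d * qGx a x ^ 2 * (-b) * ((qh a T x t + y) ^ (-b - 1) - (qh a T x t) ^ (-b - 1))
def qUyy (a b d T x y t : ℝ) : ℝ := d * (-b) * (qh a T x t + y) ^ (-b - 1)
def qUxy (a b d T x y t : ℝ) : ℝ := d * qGx a x * (-b) * (qh a T x t + y) ^ (-b - 1)

def qOm (a T : ℝ) : Set (ℝ × ℝ × ℝ) := {q | q.2.2 < T ∧ 0 < qh a T q.1 q.2.2 + q.2.1}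

lemma qh_cont {a T : ℝ} (ha : 1 < a) : Continuous (fun q : ℝ × ℝ => qh a T q.1 q.2) := by
  unfold qh
  refine Continuous.add ?_ ?_
  · exact (continuous_fst.abs).rpow_const (fun _ => Or.inr (by linarith))
  · exact (continuous_const.sub continuous_snd).rpow_const (fun _ => Or.inr (by linarith))

lemma qh_cont3 {a T : ℝ} (ha : 1 < a) :
    Continuous (fun q : ℝ × ℝ × ℝ => qh a T q.1 q.2.2) :=
  (qh_cont ha).comp (continuous_fst.prodMk continuous_snd.snd)

lemma qh_pos {a T x t : ℝ} (ht : t < T) : 0 < qh a T x t := by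
  unfold qh
  have : 0 < (T - t) ^ a := Real.rpow_pos_of_pos (by linarith) _
  have : 0 ≤ |x| ^ (2 * a) := Real.rpow_nonneg (abs_nonneg _) _
  linarith

lemma qOm_open {a T : ℝ} (ha : 1 < a) : IsOpen (qOm a T) := by
  have h1 : IsOpen {q : ℝ × ℝ × ℝ | q.2.2 < T} :=
    isOpen_lt continuous_snd.snd continuous_const
  have h2 : IsOpen {q : ℝ × ℝ × ℝ | 0 < qh a T q.1 q.2.2 + q.2.1} :=
    isOpen_lt continuous_const ((qh_cont3 ha).add continuous_snd.fst)
  exact h1.inter h2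

lemma qGx_cont {a : ℝ} (ha : 1 < a) : Continuous (qGx a) := by
  unfold qGx
  exact (continuous_const.mul (continuous_abs.rpow_const
    (fun _ => Or.inr (by linarith)))).mul continuous_id

lemma qGxx_cont {a : ℝ} (ha : 1 < a) : Continuous (qGxx a) := by
  unfold qGxx
  exact (continuous_const.mul (continuous_abs.rpow_const
    (fun _ => Or.inr (by linarith))))

lemma qG_deriv {a : ℝ} (ha : 1 < a) (x : ℝ) :
    HasDerivAt (fun s : ℝ => |s| ^ (2 * a)) (qGx a x) x :=
  hasDerivAt_abs_rpow x (by linarith)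

lemma qGx_deriv {a : ℝ} (ha : 1 < a) (x : ℝ) :
    HasDerivAt (qGx a) (qGxx a x) x := by
  have key : ∀ y : ℝ, y ≠ 0 → HasDerivAt (qGx a) (qGxx a y) y := by
    intro y hy
    have h0 : HasDerivAt (fun s : ℝ => |s|) (SignType.sign y : ℝ) y := hasDerivAt_abs hy
    have h1 := h0.rpow_const (p := 2 * a - 2) (Or.inl (abs_ne_zero.2 hy))
    have h2 := (h1.const_mul (2 * a)).mul (hasDerivAt_id y)
    refine HasDerivAt.congr_deriv (f := qGx a) h2 ?_
    unfold qGxx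
    have hs : (SignType.sign y : ℝ) * y = |y| := by rw [mul_comm, self_mul_sign]
    have hp : |y| ^ (2 * a - 2) = |y| ^ (2 * a - 2 - 1) * |y| := by
      rw [Real.rpow_sub_one (abs_ne_zero.2 hy)]
      field_simp
    have : (SignType.sign y : ℝ) * (2 * a - 2) * |y| ^ (2 * a - 2 - 1) * y
        = (2 * a - 2) * |y| ^ (2 * a - 2) := by
      rw [hp, ← hs]; ring
    simp only [id]
    linear_combination (2 * a) * this
  exact hasDerivAt_of_hasDerivAt_of_ne' (f := qGx a) (g := qGxx a) (x := 0)
    (fun y hy => key y hy) (qGx_cont ha).continuousAt (qGxx_cont ha).continuousAt x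

section
variable {a b d T : ℝ} {u : ℝ → ℝ → ℝ → ℝ}

lemma qh_dx (ha : 1 < a) (x t : ℝ) :
    HasDerivAt (fun s => qh a T s t) (qGx a x) x := by
  unfold qh
  exact (qG_deriv ha x).add_const _

lemma qh_dt (ha : 1 < a) (x t : ℝ) :
    HasDerivAt (fun s => qh a T x s) (-(a * (T - t) ^ (a - 1))) t := by
  unfold qh
  have h := ((hasDerivAt_id t).const_sub T).rpow_const (p := a) (Or.inr ha.le)
  have h := h.const_add (|x| ^ (2 * a))
  refine h.congr_deriv ?_
  simp only [id]; ring

lemma qU_dx (ha : 1 < a) (hb : b < 1)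
    (hu : ∀ x y t, u x y t = (1 - b)⁻¹ * d * ((qh a T x t + y) ^ (1 - b) - qh a T x t ^ (1 - b)))
    {x y t : ℝ} (ht : t < T) (hq : 0 < qh a T x t + y) :
    HasDerivAt (fun s => u s y t) (qUx a b d T x y t) x := by
  have h1 := ((qh_dx (T := T) ha x t).add_const y).rpow_const (p := 1 - b) (Or.inl hq.ne')
  have h2 := (qh_dx (T := T) ha x t).rpow_const (p := 1 - b) (Or.inl (qh_pos ht).ne')
  have h3 := (h1.sub h2).const_mul ((1 - b)⁻¹ * d)
  have e : (fun s => u s y t) = fun s => (1 - b)⁻¹ * d * ((qh a T s t + y) ^ (1 - b) - qh a T s t ^ (1 - b)) :=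
    funext fun s => hu s y t
  rw [e]
  refine h3.congr_deriv ?_
  have : 1 - b ≠ 0 := by linarith
  unfold qUx
  rw [show 1 - b - 1 = -b by ring]
  field_simp

lemma qU_dt (ha : 1 < a) (hb : b < 1)
    (hu : ∀ x y t, u x y t = (1 - b)⁻¹ * d * ((qh a T x t + y) ^ (1 - b) - qh a T x t ^ (1 - b)))
    {x y t : ℝ} (ht : t < T) (hq : 0 < qh a T x t + y) :
    HasDerivAt (fun s => u x y s) (qUt a b d T x y t) t := by
  have h1 := ((qh_dt (T := T) ha x t).add_const y).rpow_const (p := 1 - b) (Or.inl hq.ne')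
  have h2 := (qh_dt (T := T) ha x t).rpow_const (p := 1 - b) (Or.inl (qh_pos ht).ne')
  have h3 := (h1.sub h2).const_mul ((1 - b)⁻¹ * d)
  have e : (fun s => u x y s) = fun s => (1 - b)⁻¹ * d * ((qh a T x s + y) ^ (1 - b) - qh a T x s ^ (1 - b)) :=
    funext fun s => hu x y s
  rw [e]
  refine h3.congr_deriv ?_
  have : 1 - b ≠ 0 := by linarith
  unfold qUt
  rw [show 1 - b - 1 = -b by ring]
  field_simp
  ring

lemma qU_dy (hb : b < 1)
    (hu : ∀ x y t, u x y t = (1 - b)⁻¹ * d * ((qh a T x t + y) ^ (1 - b) - qh a T x t ^ (1 - b)))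
    {x y t : ℝ} (hq : 0 < qh a T x t + y) :
    HasDerivAt (fun s => u x s t) (qUy a b d T x y t) y := by
  have h1 := ((hasDerivAt_id y).const_add (qh a T x t)).rpow_const (p := 1 - b) (Or.inl hq.ne')
  have h3 := (h1.sub_const (qh a T x t ^ (1 - b))).const_mul ((1 - b)⁻¹ * d)
  have e : (fun s => u x s t) = fun s => (1 - b)⁻¹ * d * ((qh a T x t + s) ^ (1 - b) - qh a T x t ^ (1 - b)) :=
    funext fun s => hu x s t
  rw [e]
  refine h3.congr_deriv ?_
  have : 1 - b ≠ 0 := by linarith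
  unfold qUy
  rw [show 1 - b - 1 = -b by ring]
  simp only [id]
  field_simp

lemma qUx_dx (ha : 1 < a) {x y t : ℝ} (ht : t < T) (hq : 0 < qh a T x t + y) :
    HasDerivAt (fun s => qUx a b d T s y t) (qUxx a b d T x y t) x := by
  have h1 := ((qh_dx (T := T) ha x t).add_const y).rpow_const (p := - b) (Or.inl hq.ne')
  have h2 := (qh_dx (T := T) ha x t).rpow_const (p := - b) (Or.inl (qh_pos ht).ne')
  have h3 := ((qGx_deriv ha x).const_mul d).mul (h1.sub h2)
  refine HasDerivAt.congr_deriv h3 ?_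
  unfold qUxx
  simp only [Pi.sub_apply]
  ring

lemma qUx_dy {x y t : ℝ} (hq : 0 < qh a T x t + y) :
    HasDerivAt (fun s => qUx a b d T x s t) (qUxy a b d T x y t) y := by
  have h1 := ((hasDerivAt_id y).const_add (qh a T x t)).rpow_const (p := - b) (Or.inl hq.ne')
  have h3 := (h1.sub_const (qh a T x t ^ (- b))).const_mul (d * qGx a x)
  refine HasDerivAt.congr_deriv h3 ?_
  unfold qUxy
  simp only [id]
  ring

lemma qUy_dy {x y t : ℝ} (hq : 0 < qh a T x t + y) :
    HasDerivAt (fun s => qUy a b d T x s t) (qUyy a b d T x y t) y := by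
  have h1 := ((hasDerivAt_id y).const_add (qh a T x t)).rpow_const (p := - b) (Or.inl hq.ne')
  have h3 := h1.const_mul d
  refine HasDerivAt.congr_deriv h3 ?_
  unfold qUyy
  simp only [id]
  ring

lemma q_ev (ha : 1 < a) {x y t : ℝ} (ht : t < T) (hq : 0 < qh a T x t + y) :
    ∀ᶠ q in nhds ((x, y, t) : ℝ × ℝ × ℝ), q ∈ qOm a T :=
  (qOm_open ha).mem_nhds ⟨ht, hq⟩

lemma q_evx (ha : 1 < a) {x y t : ℝ} (ht : t < T) (hq : 0 < qh a T x t + y) :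
    ∀ᶠ s in nhds x, 0 < qh a T s t + y := by
  have h : Tendsto (fun s : ℝ => ((s, y, t) : ℝ × ℝ × ℝ)) (nhds x) (nhds (x, y, t)) :=
    (by fun_prop : Continuous (fun s : ℝ => ((s, y, t) : ℝ × ℝ × ℝ))).tendsto x
  exact (h.eventually (q_ev ha ht hq)).mono fun s hs => hs.2

lemma q_evy {x y t : ℝ} (hq : 0 < qh a T x t + y) :
    ∀ᶠ s in nhds y, 0 < qh a T x t + s :=
  (isOpen_lt continuous_const (continuous_const.add continuous_id)).mem_nhds hq

structure qAll (a b d T : ℝ) (u : ℝ → ℝ → ℝ → ℝ) (x y t : ℝ) : Prop where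
  ex : pdx u x y t = qUx a b d T x y t
  ey : pdy u x y t = qUy a b d T x y t
  et : pdt u x y t = qUt a b d T x y t
  exx : pdxx u x y t = qUxx a b d T x y t
  eyy : pdyy u x y t = qUyy a b d T x y t
  exy : pdxy u x y t = qUxy a b d T x y t
  c : C21At u x y t

lemma q_all (ha : 1 < a) (hb : b < 1)
    (hu : ∀ x y t, u x y t = (1 - b)⁻¹ * d * ((qh a T x t + y) ^ (1 - b) - qh a T x t ^ (1 - b)))
    {x y t : ℝ} (ht : t < T) (hq : 0 < qh a T x t + y) : qAll a b d T u x y t := by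
  have Ex : ∀ {x y t : ℝ}, t < T → 0 < qh a T x t + y → pdx u x y t = qUx a b d T x y t :=
    fun ht hq => (qU_dx ha hb hu ht hq).deriv
  have Ey : ∀ {x y t : ℝ}, t < T → 0 < qh a T x t + y → pdy u x y t = qUy a b d T x y t :=
    fun ht hq => (qU_dy hb hu hq).deriv
  have Et : ∀ {x y t : ℝ}, t < T → 0 < qh a T x t + y → pdt u x y t = qUt a b d T x y t :=
    fun ht hq => (qU_dt ha hb hu ht hq).deriv
  have Hxx : ∀ {x y t : ℝ}, t < T → 0 < qh a T x t + y →
      HasDerivAt (fun s => pdx u s y t) (qUxx a b d T x y t) x := fun ht hq =>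
    (qUx_dx ha ht hq).congr_of_eventuallyEq ((q_evx ha ht hq).mono fun s hs => Ex ht hs)
  have Hyy : ∀ {x y t : ℝ}, t < T → 0 < qh a T x t + y →
      HasDerivAt (fun s => pdy u x s t) (qUyy a b d T x y t) y := fun ht hq =>
    (qUy_dy hq).congr_of_eventuallyEq ((q_evy hq).mono fun s hs => Ey ht hs)
  have Hxy : ∀ {x y t : ℝ}, t < T → 0 < qh a T x t + y →
      HasDerivAt (fun s => pdx u x s t) (qUxy a b d T x y t) y := fun ht hq =>
    (qUx_dy hq).congr_of_eventuallyEq ((q_evy hq).mono fun s hs => Ex ht hs)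
  have ev := q_ev ha ht hq
  have hc : ContinuousAt (fun q : ℝ × ℝ × ℝ => qh a T q.1 q.2.2) (x, y, t) :=
    (qh_cont3 ha).continuousAt
  have hcy : ContinuousAt (fun q : ℝ × ℝ × ℝ => qh a T q.1 q.2.2 + q.2.1) (x, y, t) :=
    hc.add continuous_snd.fst.continuousAt
  have r1 : ∀ r : ℝ, ContinuousAt (fun q : ℝ × ℝ × ℝ => (qh a T q.1 q.2.2) ^ r) (x, y, t) :=
    fun r => hc.rpow_const (Or.inl (qh_pos ht).ne')
  have r2 : ∀ r : ℝ, ContinuousAt (fun q : ℝ × ℝ × ℝ => (qh a T q.1 q.2.2 + q.2.1) ^ r) (x, y, t) :=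
    fun r => hcy.rpow_const (Or.inl hq.ne')
  have g1 : ContinuousAt (fun q : ℝ × ℝ × ℝ => qGx a q.1) (x, y, t) :=
    ((qGx_cont ha).comp continuous_fst).continuousAt
  have g2 : ContinuousAt (fun q : ℝ × ℝ × ℝ => qGxx a q.1) (x, y, t) :=
    ((qGxx_cont ha).comp continuous_fst).continuousAt
  have g3 : ContinuousAt (fun q : ℝ × ℝ × ℝ => (T - q.2.2) ^ (a - 1)) (x, y, t) :=
    ((continuous_const.sub continuous_snd.snd).rpow_const
      (fun _ => Or.inr (by linarith))).continuousAt
  refine ⟨Ex ht hq, Ey ht hq, Et ht hq, (Hxx ht hq).deriv, (Hyy ht hq).deriv, (Hxy ht hq).deriv,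
    (qU_dx ha hb hu ht hq).differentiableAt, (qU_dy hb hu hq).differentiableAt,
    (qU_dt ha hb hu ht hq).differentiableAt, (Hxx ht hq).differentiableAt,
    (Hyy ht hq).differentiableAt, (Hxy ht hq).differentiableAt, ?_, ?_, ?_, ?_, ?_, ?_, ?_⟩
  · simp only [hu]
    exact continuousAt_const.mul ((r2 _).sub (r1 _))
  · refine ContinuousAt.congr_of_eventuallyEq (f := fun q : ℝ × ℝ × ℝ => qUx a b d T q.1 q.2.1 q.2.2) ?_
      (ev.mono fun q hq => Ex hq.1 hq.2)
    exact (continuousAt_const.mul g1).mul ((r2 _).sub (r1 _))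
  · refine ContinuousAt.congr_of_eventuallyEq (f := fun q : ℝ × ℝ × ℝ => qUy a b d T q.1 q.2.1 q.2.2) ?_
      (ev.mono fun q hq => Ey hq.1 hq.2)
    exact continuousAt_const.mul (r2 _)
  · refine ContinuousAt.congr_of_eventuallyEq (f := fun q : ℝ × ℝ × ℝ => qUt a b d T q.1 q.2.1 q.2.2) ?_
      (ev.mono fun q hq => Et hq.1 hq.2)
    exact (continuousAt_const.mul (continuousAt_const.mul g3).neg).mul ((r2 _).sub (r1 _))
  · refine ContinuousAt.congr_of_eventuallyEq (f := fun q : ℝ × ℝ × ℝ => qUxx a b d T q.1 q.2.1 q.2.2) ?_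
      (ev.mono fun q hq => (Hxx hq.1 hq.2).deriv)
    exact ((continuousAt_const.mul g2).mul ((r2 _).sub (r1 _))).add
      (((continuousAt_const.mul (g1.pow 2)).mul continuousAt_const).mul ((r2 _).sub (r1 _)))
  · refine ContinuousAt.congr_of_eventuallyEq (f := fun q : ℝ × ℝ × ℝ => qUyy a b d T q.1 q.2.1 q.2.2) ?_
      (ev.mono fun q hq => (Hyy hq.1 hq.2).deriv)
    exact continuousAt_const.mul (r2 _)
  · refine ContinuousAt.congr_of_eventuallyEq (f := fun q : ℝ × ℝ × ℝ => qUxy a b d T q.1 q.2.1 q.2.2) ?_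
      (ev.mono fun q hq => (Hxy hq.1 hq.2).deriv)
    exact ((continuousAt_const.mul g1).mul continuousAt_const).mul (r2 _)

end
section
variable {a b d T : ℝ}

lemma q_diff_abs {h y r : ℝ} (hh : 0 < h) (hy : 0 ≤ y) (hr : r ≤ 0) :
    |(h + y) ^ r - h ^ r| ≤ h ^ r := by
  have h1 : (h + y) ^ r ≤ h ^ r := Real.rpow_le_rpow_of_nonpos hh (by linarith) hr
  have h2 : 0 ≤ (h + y) ^ r := Real.rpow_nonneg (by linarith) _
  rw [abs_le]; constructor <;> linarith

lemma q_h_rpow {x t r : ℝ} (ht : t < T) (hx : x ≠ 0) (hr : r ≤ 0) :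
    qh a T x t ^ r ≤ |x| ^ (2 * a * r) := by
  have hX : 0 < |x| := abs_pos.2 hx
  rw [Real.rpow_mul hX.le]
  refine Real.rpow_le_rpow_of_nonpos (Real.rpow_pos_of_pos hX _) ?_ hr
  unfold qh
  have : 0 < (T - t) ^ a := Real.rpow_pos_of_pos (by linarith) _
  linarith

lemma q_h_rpow_t {x t r : ℝ} (ht : t < T) (hr : r ≤ 0) :
    qh a T x t ^ r ≤ (T - t) ^ (a * r) := by
  have hX : 0 < T - t := by linarith
  rw [Real.rpow_mul hX.le]
  refine Real.rpow_le_rpow_of_nonpos (Real.rpow_pos_of_pos hX _) ?_ hr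
  unfold qh
  have : 0 ≤ |x| ^ (2 * a) := Real.rpow_nonneg (abs_nonneg _) _
  linarith

lemma qGx_abs (ha : 1 < a) {x : ℝ} (hx : x ≠ 0) : |qGx a x| = 2 * a * |x| ^ (2 * a - 1) := by
  have hX : 0 < |x| := abs_pos.2 hx
  unfold qGx
  rw [abs_mul, abs_mul, abs_of_pos (by linarith : 0 < 2 * a),
    abs_of_nonneg (Real.rpow_nonneg hX.le _), mul_assoc,
    ← Real.rpow_add_one hX.ne']
  ring_nf

lemma qUxx_bd (ha : 1 < a) (hb : 0 < b) (hd : 0 < d)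
    {x y t : ℝ} (ht : t < T) (hy : 0 ≤ y) :
    |qUxx a b d T x y t| ≤
      d * (2 * a * (2 * a - 1) + 4 * a ^ 2 * b) * |x| ^ (2 * (a * (1 - b) - 1)) := by
  rcases eq_or_ne x 0 with rfl | hx
  · have e1 : qGx a 0 = 0 := by simp [qGx]
    have e2 : qGxx a 0 = 0 := by
      unfold qGxx; rw [abs_zero, Real.zero_rpow (by linarith), mul_zero]
    unfold qUxx
    rw [e1, e2]
    simp only [mul_zero, zero_mul, ne_eq, OfNat.ofNat_ne_zero, not_false_eq_true, zero_pow,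
      add_zero, abs_zero]
    have : 0 ≤ (0:ℝ) ^ (2 * (a * (1 - b) - 1)) := Real.rpow_nonneg le_rfl _
    have h2 : 0 ≤ 2 * a * (2 * a - 1) := by nlinarith
    positivity
  have hX : 0 < |x| := abs_pos.2 hx
  have hh : 0 < qh a T x t := qh_pos ht
  have k1 := (q_diff_abs (r := -b) hh hy (by linarith)).trans (q_h_rpow ht hx (by linarith))
  have k2 := (q_diff_abs (r := -b-1) hh hy (by linarith)).trans (q_h_rpow ht hx (by linarith))
  have hG : |qGxx a x| = 2 * a * (2 * a - 1) * |x| ^ (2 * a - 2) := by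
    unfold qGxx
    apply abs_of_nonneg
    have h2 : 0 ≤ 2 * a * (2 * a - 1) := by nlinarith
    exact mul_nonneg h2 (Real.rpow_nonneg hX.le _)
  have m1 : |x| ^ (2 * a - 2) * |x| ^ (2 * a * (-b)) = |x| ^ (2 * (a * (1 - b) - 1)) := by
    rw [← Real.rpow_add hX]; ring_nf
  have m2 : (|x| ^ (2 * a - 1)) ^ 2 * |x| ^ (2 * a * (-b-1)) = |x| ^ (2 * (a * (1 - b) - 1)) := by
    rw [← Real.rpow_natCast, ← Real.rpow_mul hX.le, ← Real.rpow_add hX]; push_cast; ring_nf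
  unfold qUxx
  refine (abs_add_le _ _).trans ?_
  rw [abs_mul, abs_mul, abs_mul, abs_mul, abs_mul, abs_of_pos hd, abs_neg, abs_of_pos hb,
    abs_pow, hG, qGx_abs ha hx]
  have hc : 0 ≤ d * (2 * a * (2 * a - 1) * |x| ^ (2 * a - 2)) := by
    rw [← hG]; positivity
  have s1 := mul_le_mul_of_nonneg_left k1 hc
  have hc2 : 0 ≤ d * (2 * a * |x| ^ (2 * a - 1)) ^ 2 * b := by positivity
  have s2 := mul_le_mul_of_nonneg_left k2 hc2
  refine (add_le_add s1 s2).trans (le_of_eq ?_)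
  rw [mul_pow]
  linear_combination (d * (2 * a * (2 * a - 1))) * m1 + (d * (2 * a) ^ 2 * b) * m2

lemma qUx_bd (ha : 1 < a) (hb : 0 < b) (hab : 1 ≤ a * (1 - b)) (hd : 0 < d)
    {x y t : ℝ} (ht : t < T) (hy : 0 ≤ y) :
    |qUx a b d T x y t| ≤ d * (2 * a) * |x| ^ (2 * (a * (1 - b)) - 1) := by
  rcases eq_or_ne x 0 with rfl | hx
  · have e1 : qGx a 0 = 0 := by simp [qGx]
    unfold qUx
    rw [e1, mul_zero, zero_mul, abs_zero]
    have : 0 ≤ |(0:ℝ)| ^ (2 * (a * (1 - b)) - 1) := Real.rpow_nonneg (abs_nonneg _) _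
    positivity
  have hX : 0 < |x| := abs_pos.2 hx
  have hh : 0 < qh a T x t := qh_pos ht
  have k1 := (q_diff_abs (r := -b) hh hy (by linarith)).trans (q_h_rpow ht hx (by linarith))
  have m1 : |x| ^ (2 * a - 1) * |x| ^ (2 * a * (-b)) = |x| ^ (2 * (a * (1 - b)) - 1) := by
    rw [← Real.rpow_add hX]; ring_nf
  unfold qUx
  rw [abs_mul, abs_mul, abs_of_pos hd, qGx_abs ha hx]
  have hc : 0 ≤ d * (2 * a * |x| ^ (2 * a - 1)) := by positivity
  refine (mul_le_mul_of_nonneg_left k1 hc).trans (le_of_eq ?_)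
  linear_combination (d * (2 * a)) * m1

lemma qUt_bd (ha : 1 < a) (hb : 0 < b) (hab : 1 ≤ a * (1 - b)) (hd : 0 < d)
    {x y t : ℝ} (ht : t ∈ Ioo 0 T) (hy : 0 ≤ y) :
    |qUt a b d T x y t| ≤ d * a * T ^ (a * (1 - b) - 1) := by
  have hX : 0 < T - t := by linarith [ht.2]
  have hh : 0 < qh a T x t := qh_pos ht.2
  have k1 := (q_diff_abs (r := -b) hh hy (by linarith)).trans (q_h_rpow_t ht.2 (by linarith))
  have m1 : (T - t) ^ (a - 1) * (T - t) ^ (a * (-b)) = (T - t) ^ (a * (1 - b) - 1) := by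
    rw [← Real.rpow_add hX]; ring_nf
  have m2 : (T - t) ^ (a * (1 - b) - 1) ≤ T ^ (a * (1 - b) - 1) :=
    Real.rpow_le_rpow hX.le (by linarith [ht.1]) (by linarith)
  unfold qUt
  have hc : 0 ≤ d * (a * (T - t) ^ (a - 1)) := by positivity
  rw [mul_neg, neg_mul, abs_neg, abs_mul, abs_of_nonneg hc]
  refine (mul_le_mul_of_nonneg_left k1 hc).trans ?_
  have := mul_le_mul_of_nonneg_left m2 (by positivity : 0 ≤ d * a)
  rw [← m1] at this
  linarith

lemma qUx_bd1 (ha : 1 < a) (hb : 0 < b) (hab : 1 ≤ a * (1 - b)) (hd : 0 < d)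
    {x y t : ℝ} (hx : |x| ≤ 1) (ht : t < T) (hy : 0 ≤ y) :
    |qUx a b d T x y t| ≤ d * (2 * a) := by
  refine (qUx_bd ha hb hab hd ht hy).trans ?_
  have : |x| ^ (2 * (a * (1 - b)) - 1) ≤ 1 :=
    Real.rpow_le_one (abs_nonneg _) hx (by linarith)
  exact mul_le_of_le_one_right (by positivity) this

lemma qUxx_bd1 (ha : 1 < a) (hb : 0 < b) (hab : 1 ≤ a * (1 - b)) (hd : 0 < d)
    {x y t : ℝ} (hx : |x| ≤ 1) (ht : t < T) (hy : 0 ≤ y) :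
    |qUxx a b d T x y t| ≤ d * (2 * a * (2 * a - 1) + 4 * a ^ 2 * b) := by
  refine (qUxx_bd ha hb hd ht hy).trans ?_
  have : |x| ^ (2 * (a * (1 - b) - 1)) ≤ 1 :=
    Real.rpow_le_one (abs_nonneg _) hx (by linarith)
  have h2 : 0 ≤ 2 * a * (2 * a - 1) := by nlinarith
  exact mul_le_of_le_one_right (by positivity) this

lemma q_grad_pow {A B K L p : ℝ} (hA : 0 < A) (hp : 2 < p) (hK : 0 ≤ K)
    (hB : B ^ 2 ≤ K * A ^ 2) (hL : B ^ 2 * A ^ (p - 2) ≤ L) :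
    |Real.sqrt (B ^ 2 + A ^ 2) ^ p - A ^ p| ≤ p / 2 * (1 + K) ^ (p / 2 - 1) * L := by
  have hS : 0 < B ^ 2 + A ^ 2 := by positivity
  set S := B ^ 2 + A ^ 2 with hSd
  have e1 : Real.sqrt S ^ p = S ^ (p / 2) := by
    rw [Real.sqrt_eq_rpow, ← Real.rpow_mul hS.le]; ring_nf
  have e2 : A ^ p = (A ^ 2) ^ (p / 2) := by
    rw [← Real.rpow_natCast, ← Real.rpow_mul hA.le]; push_cast; ring_nf
  have e3 : A ^ (p - 2) = (A ^ 2) ^ (p / 2 - 1) := by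
    rw [← Real.rpow_natCast, ← Real.rpow_mul hA.le]; push_cast; ring_nf
  have hle : A ^ p ≤ S ^ (p / 2) := by
    rw [e2]
    exact Real.rpow_le_rpow (by positivity) (by rw [hSd]; nlinarith [sq_nonneg B]) (by linarith)
  have e4 : (1 + -(B ^ 2 / S)) = A ^ 2 / S := by
    field_simp; rw [hSd]; ring
  have b1 : -1 ≤ -(B ^ 2 / S) := by
    have : 0 ≤ A ^ 2 / S := by positivity
    linarith
  have b2 := one_add_mul_self_le_rpow_one_add b1 (p := p / 2) (by linarith)
  rw [e4, Real.div_rpow (by positivity) hS.le, ← e2] at b2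
  have hSq : 0 < S ^ (p / 2) := Real.rpow_pos_of_pos hS _
  have b3 := mul_le_mul_of_nonneg_left b2 hSq.le
  have e5 : S ^ (p / 2) * (A ^ p / S ^ (p / 2)) = A ^ p := by field_simp
  have e6 : S ^ (p / 2) = S ^ (p / 2 - 1) * S := by
    rw [Real.rpow_sub_one hS.ne']; field_simp
  have e7 : S ^ (p / 2) * (1 + p / 2 * -(B ^ 2 / S)) = S ^ (p / 2) - p / 2 * B ^ 2 * S ^ (p / 2 - 1) := by
    rw [e6]; field_simp
    try ring
  rw [e5, e7] at b3
  have b4 : S ^ (p / 2 - 1) ≤ (1 + K) ^ (p / 2 - 1) * A ^ (p - 2) := by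
    rw [e3, ← Real.mul_rpow (by linarith) (by positivity)]
    exact Real.rpow_le_rpow hS.le (by rw [hSd]; linarith) (by linarith)
  rw [e1, abs_of_nonneg (by linarith)]
  have b5 : p / 2 * B ^ 2 * S ^ (p / 2 - 1) ≤ p / 2 * B ^ 2 * ((1 + K) ^ (p / 2 - 1) * A ^ (p - 2)) :=
    mul_le_mul_of_nonneg_left b4 (by positivity)
  have b6 : p / 2 * (1 + K) ^ (p / 2 - 1) * (B ^ 2 * A ^ (p - 2)) ≤ p / 2 * (1 + K) ^ (p / 2 - 1) * L :=
    mul_le_mul_of_nonneg_left hL (by positivity)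
  nlinarith [b3, b5, b6]

lemma qUy_pos (hd : 0 < d) {x y t : ℝ} (ht : t < T) (hy : 0 ≤ y) :
    0 < qUy a b d T x y t := by
  have := qh_pos (a := a) (x := x) ht
  unfold qUy
  positivity

lemma qUy_lower (ha : 1 < a) (hb : 0 < b) (hd : 0 < d) {x y t : ℝ} (hx : |x| ≤ 1)
    (ht : t ∈ Ioo 0 T) (hy : 0 ≤ y) (hy1 : y ≤ 1) :
    d * (2 + T ^ a) ^ (-b) ≤ qUy a b d T x y t := by
  have h0 := qh_pos (a := a) (x := x) ht.2
  unfold qUy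
  refine mul_le_mul_of_nonneg_left (Real.rpow_le_rpow_of_nonpos (by linarith) ?_ (by linarith)) hd.le
  unfold qh
  have h1 : |x| ^ (2 * a) ≤ 1 := Real.rpow_le_one (abs_nonneg _) hx (by linarith)
  have h2 : (T - t) ^ a ≤ T ^ a := Real.rpow_le_rpow (by linarith [ht.2]) (by linarith [ht.1]) (by linarith)
  linarith

lemma q_cross (ha : 1 < a) (hb : 0 < b) (hb1 : b < 1) (hab : 1 ≤ a * (1 - b)) (hd : 0 < d) {p : ℝ}
    (hp : b * (p - 2) = 1 - b)
    {x y t : ℝ} (hx : |x| ≤ 1) (ht : t < T) (hy : 0 ≤ y) :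
    (qUx a b d T x y t) ^ 2 * (qUy a b d T x y t) ^ (p - 2) ≤ (d * (2 * a)) ^ 2 * d ^ (p - 2) := by
  rcases eq_or_ne x 0 with rfl | hx0
  · have e1 : qGx a 0 = 0 := by simp [qGx]
    have : qUx a b d T 0 y t = 0 := by unfold qUx; rw [e1]; ring
    rw [this]
    have : 0 < d ^ (p - 2) := Real.rpow_pos_of_pos hd _
    have : 0 ≤ (d * (2 * a)) ^ 2 * d ^ (p - 2) := by positivity
    simpa using this
  have hX : 0 < |x| := abs_pos.2 hx0
  have hh : 0 < qh a T x t := qh_pos ht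
  have k1 := qUx_bd ha hb hab hd ht hy (x := x)
  have k2 : (qUx a b d T x y t) ^ 2 ≤ (d * (2 * a)) ^ 2 * |x| ^ (4 * (a * (1 - b)) - 2) := by
    rw [← sq_abs]
    refine (pow_le_pow_left₀ (abs_nonneg _) k1 2).trans (le_of_eq ?_)
    rw [mul_pow, ← Real.rpow_natCast (|x| ^ _), ← Real.rpow_mul hX.le]; push_cast; ring_nf
  have k3 : (qUy a b d T x y t) ^ (p - 2) ≤ d ^ (p - 2) * |x| ^ (2 * a * (-(1 - b))) := by
    unfold qUy
    rw [Real.mul_rpow hd.le (by positivity), ← Real.rpow_mul (by positivity)]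
    refine mul_le_mul_of_nonneg_left ?_ (by positivity)
    rw [show -b * (p - 2) = -(1 - b) by linarith]
    refine (Real.rpow_le_rpow_of_nonpos hh (by linarith) (by linarith)).trans
      (q_h_rpow ht hx0 (by linarith))
  have hUy := qUy_pos (a := a) (b := b) hd (x := x) ht hy
  refine (mul_le_mul k2 k3 (by positivity) (by positivity)).trans ?_
  have m : |x| ^ (4 * (a * (1 - b)) - 2) * |x| ^ (2 * a * (-(1 - b))) ≤ 1 := by
    rw [← Real.rpow_add hX]
    exact Real.rpow_le_one hX.le hx (by nlinarith)
  have : 0 ≤ (d * (2 * a)) ^ 2 * d ^ (p - 2) := by positivity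
  have := mul_le_mul_of_nonneg_left m this
  linarith

lemma q_eik {p : ℝ} (hb : 0 < b) (hd : d = b ^ b) (hp : b * p = 1 + b)
    {x y t : ℝ} (ht : t < T) (hy : 0 ≤ y) :
    qUyy a b d T x y t + qUy a b d T x y t ^ p = 0 := by
  have hh : 0 < qh a T x t := qh_pos ht
  have hd0 : 0 < d := by rw [hd]; positivity
  unfold qUyy qUy
  rw [Real.mul_rpow hd0.le (by positivity), ← Real.rpow_mul (by positivity)]
  have : d ^ p = b * d := by
    rw [hd, ← Real.rpow_mul hb.le, hp, Real.rpow_add hb, Real.rpow_one]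
  rw [this, show -b * p = -b - 1 by linarith]
  ring

end
lemma q_const {a b d T : ℝ} (hb : 0 < b) (hab : a * (1 - b) = 1) {m x : ℝ}
    (hm : m = 2 ^ (1 / b)) (hx : 0 < x) :
    qUxx a b d T x (2 * x ^ (2 * a) * (m - 1)) (T - x ^ 2)
      = -(d * 2 ^ (-b) * a * (1 + (a - 1) / m)) := by
  have hm0 : 0 < m := by rw [hm]; positivity
  have hX : 0 < x ^ (2 * a) := by positivity
  have hh : qh a T x (T - x ^ 2) = 2 * x ^ (2 * a) := by
    unfold qh
    rw [abs_of_pos hx, sub_sub_cancel, ← Real.rpow_natCast, ← Real.rpow_mul hx.le]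
    push_cast; ring
  have hhy : 2 * x ^ (2 * a) + 2 * x ^ (2 * a) * (m - 1) = 2 * x ^ (2 * a) * m := by ring
  have m1 : m ^ (-b) = 1 / 2 := by
    rw [hm, ← Real.rpow_mul (by norm_num), show 1 / b * -b = -1 by field_simp, Real.rpow_neg_one]
    norm_num
  have m2 : m ^ (-b - 1) = 1 / 2 / m := by rw [Real.rpow_sub_one hm0.ne', m1]
  have t2 : (2:ℝ) ^ (-b - 1) = 2 ^ (-b) / 2 := by rw [Real.rpow_sub_one (by norm_num)]
  have x1 : x ^ (2 * a - 2) * (x ^ (2 * a)) ^ (-b) = 1 := by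
    rw [← Real.rpow_mul hx.le, ← Real.rpow_add hx,
      show 2 * a - 2 + 2 * a * -b = 0 by linarith, Real.rpow_zero]
  have x2 : (x ^ (2 * a - 2) * x) ^ 2 * (x ^ (2 * a)) ^ (-b - 1) = 1 := by
    rw [← Real.rpow_add_one hx.ne', ← Real.rpow_natCast, ← Real.rpow_mul hx.le,
      ← Real.rpow_mul hx.le, ← Real.rpow_add hx]
    push_cast
    rw [show (2 * a - 2 + 1) * 2 + 2 * a * (-b - 1) = 0 by linarith, Real.rpow_zero]
  unfold qUxx qGx qGxx
  rw [hh, hhy, abs_of_pos hx, Real.mul_rpow (by positivity) hm0.le,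
    Real.mul_rpow (by positivity) hm0.le, Real.mul_rpow (by positivity) hX.le,
    Real.mul_rpow (by positivity) hX.le, m1, m2, t2]
  generalize (2:ℝ) ^ (-b) = w at *
  generalize x ^ (2 * a - 2) = g at *
  generalize (x ^ (2 * a)) ^ (-b) = k at *
  generalize (x ^ (2 * a)) ^ (-b - 1) = l at *
  have E : d * (2 * a * (2 * a - 1) * g) * (w * k * (1 / 2) - w * k) +
      d * (2 * a * g * x) ^ 2 * -b * (w / 2 * l * (1 / 2 / m) - w / 2 * l)
      = d * w * (-(a * (2 * a - 1)) * (g * k) + 2 * a ^ 2 * b * (1 - 1 / 2 / m) * ((g * x) ^ 2 * l)) := by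
    ring
  rw [E, x1, x2]
  field_simp
  linear_combination (d * w * a * (1 - 2 * m)) * hab

/-- Remark 6.1: the explicit function
`u(x,y,t) = c_p [(|x|^{2α} + (T-t)^α + y)^{1-β} - (|x|^{2α} + (T-t)^α)^{1-β}]`,
with `β = 1/(p-1)`, `c_p = (1-β)⁻¹ β^β` and `α ≥ (p-1)/(p-2)`, vanishes on
`{y = 0}`, solves `u_t - Δu = |∇u|^p + f` in `Q = (-1,1) × (0,1) × (0,T)` with a
bounded source `f`, has an isolated gradient blow-up point at `(0,0,T)`,
satisfies `u_xx ≥ -C` and `|u_t| ≤ C`, and `u_xx` extends continuously to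
`(0,0,T)` (with zero limit) if and only if `α > (p-1)/(p-2)`. -/
theorem explicit_quasistationary_example (p T α : ℝ) (hp : 2 < p) (hT : 0 < T)
    (hα : (p - 1) / (p - 2) ≤ α) (u : ℝ → ℝ → ℝ → ℝ)
    (hu : ∀ x y t : ℝ, u x y t =
      (1 - 1/(p-1))⁻¹ * ((1/(p-1) : ℝ) ^ (1/(p-1))) *
        ((|x| ^ (2 * α) + (T - t) ^ α + y) ^ (1 - 1/(p-1))
          - (|x| ^ (2 * α) + (T - t) ^ α) ^ (1 - 1/(p-1)))) :
    (∀ x t : ℝ, u x 0 t = 0) ∧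
    (∀ x y t : ℝ, x ∈ Ioo (-1:ℝ) 1 → y ∈ Ioo (0:ℝ) 1 → t ∈ Ioo 0 T →
      C21At u x y t) ∧
    (∃ f : ℝ → ℝ → ℝ → ℝ,
      (∃ M : ℝ, ∀ x y t : ℝ, x ∈ Ioo (-1:ℝ) 1 → y ∈ Ioo (0:ℝ) 1 → t ∈ Ioo 0 T →
        |f x y t| ≤ M) ∧
      (∀ x y t : ℝ, x ∈ Ioo (-1:ℝ) 1 → y ∈ Ioo (0:ℝ) 1 → t ∈ Ioo 0 T →
        pdt u x y t - (pdxx u x y t + pdyy u x y t)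
          = gradNorm u x y t ^ p + f x y t)) ∧
    IsolatedGBU 1 T u ∧
    (∃ C : ℝ, 0 < C ∧ ∀ x y t : ℝ, x ∈ Ioo (-1:ℝ) 1 → y ∈ Ioo (0:ℝ) 1 →
      t ∈ Ioo 0 T → -C ≤ pdxx u x y t ∧ |pdt u x y t| ≤ C) ∧
    (Filter.Tendsto (fun q : ℝ × ℝ × ℝ => pdxx u q.1 q.2.1 q.2.2)
        (nhdsWithin ((0:ℝ), (0:ℝ), T)
          {q : ℝ × ℝ × ℝ | q.1 ∈ Ioo (-1:ℝ) 1 ∧ q.2.1 ∈ Ioo (0:ℝ) 1 ∧ q.2.2 ∈ Ioo 0 T})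
        (nhds 0)
      ↔ (p - 1) / (p - 2) < α) := by
  have hp1 : 0 < p - 1 := by linarith
  have hp2 : 0 < p - 2 := by linarith
  obtain ⟨b, hbd⟩ : ∃ b, b = 1 / (p - 1) := ⟨_, rfl⟩
  obtain ⟨d, hdd⟩ : ∃ d, d = b ^ b := ⟨_, rfl⟩
  rw [← hbd, ← hdd] at hu
  have hb : 0 < b := by rw [hbd]; positivity
  have hbp : b * (p - 1) = 1 := by rw [hbd]; field_simp
  have hb1 : b < 1 := by nlinarith
  have hd : 0 < d := by rw [hdd]; positivity
  have h1b : 1 - b = (p - 2) / (p - 1) := by rw [hbd]; field_simp; ring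
  have hab : 1 ≤ α * (1 - b) := by
    rw [div_le_iff₀ hp2] at hα
    rw [h1b, mul_div_assoc', le_div_iff₀ hp1]; linarith
  have hablt : (p - 1) / (p - 2) < α ↔ 1 < α * (1 - b) := by
    rw [div_lt_iff₀ hp2, h1b, mul_div_assoc', lt_div_iff₀ hp1, one_mul]
  have ha : 1 < α := by
    have : 1 < (p - 1) / (p - 2) := by rw [lt_div_iff₀ hp2]; linarith
    linarith
  have hu' : ∀ x y t, u x y t =
      (1 - b)⁻¹ * d * ((qh α T x t + y) ^ (1 - b) - qh α T x t ^ (1 - b)) := hu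
  have all : ∀ {x y t : ℝ}, t < T → 0 ≤ y → qAll α b d T u x y t := fun {x y t} ht hy =>
    q_all ha hb1 hu' ht (by linarith [qh_pos (a := α) (x := x) ht])
  have habs : ∀ {x : ℝ}, x ∈ Ioo (-1:ℝ) 1 → |x| ≤ 1 := fun hx => abs_le.2 ⟨hx.1.le, hx.2.le⟩
  clear hu
  refine ⟨?_, ?_, ?_, ?_, ?_, ?_⟩
  · intro x t; rw [hu']; simp
  · intro x y t hx hy ht
    exact (all ht.2 hy.1.le).c
  · refine ⟨fun x y t => pdt u x y t - (pdxx u x y t + pdyy u x y t) - gradNorm u x y t ^ p,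
      ?_, fun x y t _ _ _ => by ring⟩
    set m := d * (2 + T ^ α) ^ (-b) with hm
    have hm0 : 0 < m := by positivity
    set K := (d * (2 * α)) ^ 2 / m ^ 2 with hK
    refine ⟨d * α * T ^ (α * (1 - b) - 1) + d * (2 * α * (2 * α - 1) + 4 * α ^ 2 * b) +
      p / 2 * (1 + K) ^ (p / 2 - 1) * ((d * (2 * α)) ^ 2 * d ^ (p - 2)), ?_⟩
    intro x y t hx hy ht
    have A := all (x := x) ht.2 hy.1.le
    have b1 := qUt_bd ha hb hab hd ht hy.1.le (x := x)
    have b2 := qUxx_bd1 ha hb hab hd (habs hx) ht.2 hy.1.le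
    have e := q_eik (a := α) (x := x) (p := p) hb hdd (by linarith) ht.2 hy.1.le
    have b3 := qUx_bd1 ha hb hab hd (habs hx) ht.2 hy.1.le
    have b4 := qUy_lower ha hb hd (habs hx) ht hy.1.le hy.2.le
    have b5 := q_cross ha hb hb1 hab hd (p := p) (by linarith) (habs hx) ht.2 hy.1.le
    have b6 := q_grad_pow (K := K) (qUy_pos (a := α) (b := b) (x := x) hd ht.2 hy.1.le) hp (by positivity) (by
      have s1 : (qUx α b d T x y t) ^ 2 ≤ (d * (2 * α)) ^ 2 := by
        rw [← sq_abs]; exact pow_le_pow_left₀ (abs_nonneg _) b3 2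
      have s2 : m ^ 2 ≤ (qUy α b d T x y t) ^ 2 := pow_le_pow_left₀ hm0.le b4 2
      have s3 : (d * (2 * α)) ^ 2 = K * m ^ 2 := by rw [hK]; field_simp
      have s4 : K * m ^ 2 ≤ K * (qUy α b d T x y t) ^ 2 :=
        mul_le_mul_of_nonneg_left s2 (by positivity)
      linarith) b5
    simp only [gradNorm]
    rw [A.ex, A.ey, A.et, A.exx, A.eyy]
    rw [abs_le] at b1 b2 b6 ⊢
    constructor <;> linarith [b1.1, b1.2, b2.1, b2.2, b6.1, b6.2]
  · constructor
    · intro M δ hδ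
      -- path x = 0, y = 0
      have hev : Tendsto (fun s : ℝ => d * (s ^ α) ^ (-b)) (nhdsWithin 0 (Ioi 0)) atTop := by
        refine Tendsto.const_mul_atTop hd ?_
        have : Tendsto (fun s : ℝ => s ^ (α * (-b))) (nhdsWithin 0 (Ioi 0)) atTop :=
          tendsto_rpow_neg_nhdsGT_zero (by nlinarith)
        refine this.congr' ?_
        filter_upwards [self_mem_nhdsWithin] with s hs
        rw [Real.rpow_mul (le_of_lt hs)]
      have hsm : ∀ᶠ s in nhdsWithin (0:ℝ) (Ioi 0), s < min δ T :=
        mem_nhdsWithin_of_mem_nhds (Iio_mem_nhds (lt_min hδ hT))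
      obtain ⟨s, h1, h2, h3⟩ :=
        ((hev.eventually (eventually_gt_atTop M)).and (hsm.and self_mem_nhdsWithin)).exists
      have h3 : 0 < s := h3
      have hsδ : s < δ := h2.trans_le (min_le_left _ _)
      have hsT : s < T := h2.trans_le (min_le_right _ _)
      refine ⟨0, 0, T - s, by simp, by simp, ⟨by linarith, by linarith⟩, by simpa, by simpa,
        by linarith, ?_⟩
      have A := all (x := 0) (y := 0) (t := T - s) (by linarith) le_rfl
      have hy := qUy_pos (a := α) (b := b) hd (T := T) (x := 0) (y := 0) (t := T - s) (by linarith) le_rfl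
      have : M < qUy α b d T 0 0 (T - s) := by
        unfold qUy qh
        rw [abs_zero, Real.zero_rpow (by linarith), sub_sub_cancel, zero_add, add_zero]
        exact h1
      simp only [gradNorm]
      rw [A.ex, A.ey]
      refine this.trans_le (Real.le_sqrt_of_sq_le ?_)
      nlinarith [sq_nonneg (qUx α b d T 0 0 (T - s))]
    · intro K hK hKs
      have hcont : ContinuousOn (fun q : ℝ × ℝ => (|q.1| ^ (2 * α) + q.2) ^ (-b)) K := by
        have c1 : Continuous (fun q : ℝ × ℝ => |q.1| ^ (2 * α) + q.2) :=
          ((continuous_fst.abs).rpow_const (fun _ => Or.inr (by linarith))).add continuous_snd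
        refine c1.continuousOn.rpow_const ?_
        intro q hq
        left
        obtain ⟨⟨h1, h2⟩, h3⟩ := hKs hq
        have hq2 : 0 ≤ q.2 := h2.1
        have h4 : 0 ≤ |q.1| ^ (2 * α) := Real.rpow_nonneg (abs_nonneg _) _
        intro h0
        apply h3
        have e2 : q.2 = 0 := by linarith
        have e1 : |q.1| ^ (2 * α) = 0 := by linarith
        rw [Real.rpow_eq_zero (abs_nonneg _) (by linarith), abs_eq_zero] at e1
        exact Prod.ext e1 e2
      obtain ⟨M, hM⟩ := hK.exists_bound_of_continuousOn hcont
      refine ⟨d * (2 * α) + d * M, ?_⟩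
      intro q hq t ht
      obtain ⟨⟨h1, h2⟩, h3⟩ := hKs hq
      have hq2 : 0 ≤ q.2 := h2.1
      have A := all (x := q.1) ht.2 hq2
      have b3 := qUx_bd1 ha hb hab hd (abs_le.2 h1) ht.2 hq2
      have h4 : 0 ≤ |q.1| ^ (2 * α) := Real.rpow_nonneg (abs_nonneg _) _
      have hpos : 0 < |q.1| ^ (2 * α) + q.2 := by
        refine lt_of_le_of_ne (by linarith) (fun h0 => h3 ?_)
        have e2 : q.2 = 0 := by linarith
        have e1 : |q.1| ^ (2 * α) = 0 := by linarith
        rw [Real.rpow_eq_zero (abs_nonneg _) (by linarith), abs_eq_zero] at e1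
        exact Prod.ext e1 e2
      have b4 : qUy α b d T q.1 q.2 t ≤ d * M := by
        unfold qUy
        refine mul_le_mul_of_nonneg_left ?_ hd.le
        have h5 := (le_abs_self _).trans (hM q hq)
        refine le_trans (Real.rpow_le_rpow_of_nonpos hpos ?_ (by linarith)) h5
        unfold qh
        have : 0 < (T - t) ^ α := Real.rpow_pos_of_pos (by linarith [ht.2]) _
        linarith
      have hy := qUy_pos (a := α) (b := b) hd (x := q.1) ht.2 hq2
      simp only [gradNorm]
      rw [A.ex, A.ey]
      have h6 : 0 ≤ d * (2 * α) := by positivity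
      refine Real.sqrt_le_iff.2 ⟨by linarith, ?_⟩
      have s1 : (qUx α b d T q.1 q.2 t) ^ 2 ≤ (d * (2 * α)) ^ 2 := by
        rw [← sq_abs]; exact pow_le_pow_left₀ (abs_nonneg _) b3 2
      have s2 := pow_le_pow_left₀ hy.le b4 2
      nlinarith [mul_nonneg h6 (hy.le.trans b4)]
  · have h2 : 0 < 2 * α * (2 * α - 1) := by nlinarith
    refine ⟨d * α * T ^ (α * (1 - b) - 1) + d * (2 * α * (2 * α - 1) + 4 * α ^ 2 * b),
      by positivity, ?_⟩
    intro x y t hx hy ht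
    have A := all (x := x) ht.2 hy.1.le
    have b1 := qUt_bd ha hb hab hd ht hy.1.le (x := x)
    have b2 := qUxx_bd1 ha hb hab hd (habs hx) ht.2 hy.1.le
    have p1 : 0 < d * α * T ^ (α * (1 - b) - 1) := by positivity
    have p2 : 0 < d * (2 * α * (2 * α - 1) + 4 * α ^ 2 * b) := by positivity
    rw [A.et, A.exx]
    exact ⟨by linarith [(abs_le.1 b2).1], by linarith⟩
  · rw [hablt]
    constructor
    · intro hlim
      by_contra hcon
      have hab1 : α * (1 - b) = 1 := le_antisymm (not_lt.1 hcon) hab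
      obtain ⟨m, hm⟩ : ∃ m : ℝ, m = 2 ^ (1 / b) := ⟨_, rfl⟩
      have hm1 : 1 < m := by rw [hm]; exact Real.one_lt_rpow (by norm_num) (by positivity)
      set γ : ℝ → ℝ × ℝ × ℝ := fun x => (x, 2 * |x| ^ (2 * α) * (m - 1), T - x ^ 2) with hγ
      have c1 : Continuous (fun x : ℝ => 2 * |x| ^ (2 * α) * (m - 1)) :=
        (continuous_const.mul (continuous_abs.rpow_const
          (fun _ => Or.inr (by linarith)))).mul continuous_const
      have c2 : Continuous (fun x : ℝ => T - x ^ 2) := by fun_prop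
      have cγ : Continuous γ := continuous_id.prodMk (c1.prodMk c2)
      have v1 : 2 * |(0:ℝ)| ^ (2 * α) * (m - 1) = 0 := by
        rw [abs_zero, Real.zero_rpow (by linarith)]; ring
      have hγ0 : γ 0 = (0, 0, T) := by
        simp only [hγ]; rw [v1]; simp
      have ev1 : ∀ᶠ x in nhdsWithin (0:ℝ) (Ioi 0), x < 1 :=
        mem_nhdsWithin_of_mem_nhds (Iio_mem_nhds one_pos)
      have ev2 : ∀ᶠ x in nhdsWithin (0:ℝ) (Ioi 0), 2 * |x| ^ (2 * α) * (m - 1) < 1 :=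
        mem_nhdsWithin_of_mem_nhds ((isOpen_lt c1 continuous_const).mem_nhds
          (by show 2 * |(0:ℝ)| ^ (2 * α) * (m - 1) < 1; rw [v1]; exact one_pos))
      have ev3 : ∀ᶠ x in nhdsWithin (0:ℝ) (Ioi 0), 0 < T - x ^ 2 :=
        mem_nhdsWithin_of_mem_nhds ((isOpen_lt continuous_const c2).mem_nhds
          (by show 0 < T - (0:ℝ) ^ 2; simpa))
      have tγ : Tendsto γ (nhdsWithin 0 (Ioi 0)) (nhdsWithin ((0:ℝ), (0:ℝ), T)
          {q : ℝ × ℝ × ℝ | q.1 ∈ Ioo (-1:ℝ) 1 ∧ q.2.1 ∈ Ioo (0:ℝ) 1 ∧ q.2.2 ∈ Ioo 0 T}) := by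
        refine tendsto_nhdsWithin_iff.2 ⟨?_, ?_⟩
        · rw [← hγ0]
          exact (cγ.tendsto 0).mono_left nhdsWithin_le_nhds
        · filter_upwards [ev1, ev2, ev3, self_mem_nhdsWithin] with x h1 h2 h3 h4
          have h4 : 0 < x := h4
          refine ⟨⟨by simp only [hγ]; linarith, h1⟩, ⟨?_, h2⟩, ⟨h3, ?_⟩⟩
          · simp only [hγ]
            have : 0 < m - 1 := by linarith
            have : 0 < |x| := abs_pos.2 h4.ne'
            positivity
          · simp only [hγ]
            have : 0 < x ^ 2 := by positivity
            linarith
      have lim2 := hlim.comp tγ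
      have lim3 : Tendsto (fun _ : ℝ => -(d * 2 ^ (-b) * α * (1 + (α - 1) / m)))
          (nhdsWithin (0:ℝ) (Ioi 0)) (nhds 0) := by
        refine lim2.congr' ?_
        filter_upwards [self_mem_nhdsWithin] with x h4
        have h4 : 0 < x := h4
        have : 0 < m - 1 := by linarith
        have hx2 : 0 < x ^ 2 := by positivity
        simp only [Function.comp, hγ]
        rw [(all (by linarith) (by positivity)).exx, abs_of_pos h4]
        exact q_const hb hab1 hm h4
      have := tendsto_nhds_unique lim3 tendsto_const_nhds
      have h5 : 0 < α - 1 := by linarith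
      have : 0 < d * 2 ^ (-b) * α * (1 + (α - 1) / m) := by positivity
      linarith
    · intro hlt
      have hr : 0 < 2 * (α * (1 - b) - 1) := by linarith
      have c : Continuous (fun q : ℝ × ℝ × ℝ =>
          d * (2 * α * (2 * α - 1) + 4 * α ^ 2 * b) * |q.1| ^ (2 * (α * (1 - b) - 1))) :=
        continuous_const.mul (continuous_fst.abs.rpow_const (fun _ => Or.inr hr.le))
      have lim := (c.tendsto ((0:ℝ), (0:ℝ), T))
      simp only [abs_zero] at lim
      rw [Real.zero_rpow hr.ne', mul_zero] at lim
      refine squeeze_zero_norm' ?_ (lim.mono_left nhdsWithin_le_nhds)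
      filter_upwards [self_mem_nhdsWithin] with q hq
      obtain ⟨hx, hy, ht⟩ := hq
      rw [(all ht.2 hy.1.le).exx, Real.norm_eq_abs]
      exact qUxx_bd ha hb hd ht.2 hy.1.le
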